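/- Let u = √3/2 and let B₂₁ be the arrangement of 21 lines in ℙ²(ℝ) obtained from the seven linear forms x−uz, x+uz, x−4uz, x+4uz, y, y−z, y+z together with their images under the rotations by 60° and 120° about (0:0:1). Then the set of points of ℙ²(ℝ) lying on at least two of these 21 lines has exactly 115 elements, and the number tᵢ of points lying on exactly i of the lines is: t₂ = 72, t₃ = 40, t₄ = 3, and tᵢ = 0 for all other i ≥ 2. -/

import Mathlib

open MvPolynomial

noncomputable section

/-- The polynomial ring `ℝ[x,y,z]`, with `x = X 0`, `y = X 1`, `z = X 2`. -/
abbrev PolyR := MvPolynomial (Fin 3) ℝ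

/-- `u = √3 / 2`. -/
def u : ℝ := Real.sqrt 3 / 2

/-- The rotation by 60° about `(0:0:1)`. -/
def rotA : Matrix (Fin 3) (Fin 3) ℝ := !![1/2, -u, 0; u, 1/2, 0; 0, 0, 1]

/-- Linear substitution of variables by a matrix `M`:  `(substMat M f)(v) = f(M v)`. -/
def substMat (M : Matrix (Fin 3) (Fin 3) ℝ) : PolyR →ₐ[ℝ] PolyR :=
  MvPolynomial.aeval fun i => ∑ j, MvPolynomial.C (M i j) * MvPolynomial.X j

/-- The seven initial linear forms of the arrangement `B₂₁`:
`x ∓ uz`, `x ∓ 4uz`, `y`, `y ∓ z`. -/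
def baseFormsB : Fin 7 → PolyR :=
  ![X 0 - C u * X 2, X 0 + C u * X 2, X 0 - C (4*u) * X 2, X 0 + C (4*u) * X 2,
    X 1, X 1 - X 2, X 1 + X 2]

/-- The 21 linear forms defining the arrangement `B₂₁`: the seven initial forms and their
images under the rotations by 60° and 120° about `(0:0:1)` (the image of a line `{ℓ = 0}`
under a matrix `M` being `{ℓ ∘ M⁻¹ = 0}`). -/
def linesB21 : Fin 21 → PolyR := fun i =>
  if h : (i : ℕ) < 7 then baseFormsB ⟨i, h⟩
  else if h2 : (i : ℕ) < 14 then substMat rotA⁻¹ (baseFormsB ⟨(i : ℕ) - 7, by omega⟩)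
  else substMat (rotA ^ 2)⁻¹ (baseFormsB ⟨(i : ℕ) - 14, by omega⟩)

/-- The real projective plane `ℙ²(ℝ)`. -/
abbrev P2R := Projectivization ℝ (Fin 3 → ℝ)

open Classical in
/-- The number of lines of `B₂₁` passing through a point `P ∈ ℙ²(ℝ)`. -/
def multB21 (P : P2R) : ℕ :=
  (Finset.univ.filter fun i => MvPolynomial.eval (Projectivization.rep P) (linesB21 i) = 0).card

/-- The set of intersection points of `B₂₁`: points lying on at least two lines. -/
def T21 : Set P2R := {P | 2 ≤ multB21 P}

end

/-- Integer coefficients of the 21 lines in the coordinates `(x/u, y, z)`. -/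
def cf : Fin 21 → ℤ × ℤ × ℤ :=
  ![(1,0,-1), (1,0,1), (1,0,-4), (1,0,4), (0,1,0), (0,1,-1), (0,1,1),
    (1,2,-2), (1,2,2), (1,2,-8), (1,2,8), (-3,2,0), (-3,2,-4), (-3,2,4),
    (-1,2,-2), (-1,2,2), (-1,2,-8), (-1,2,8), (-3,-2,0), (-3,-2,-4), (-3,-2,4)]

/-- Cross product of two of the coefficient vectors. -/
def crz (p : Fin 21 × Fin 21) : ℤ × ℤ × ℤ :=
  ((cf p.1).2.1 * (cf p.2).2.2 - (cf p.1).2.2 * (cf p.2).2.1,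
   (cf p.1).2.2 * (cf p.2).1 - (cf p.1).1 * (cf p.2).2.2,
   (cf p.1).1 * (cf p.2).2.1 - (cf p.1).2.1 * (cf p.2).1)

def dtz (p : Fin 21 × Fin 21) (k : Fin 21) : ℤ :=
  (cf k).1 * (crz p).1 + (cf k).2.1 * (crz p).2.1 + (cf k).2.2 * (crz p).2.2

def zInt (p : Fin 21 × Fin 21) : Finset (Fin 21) := Finset.univ.filter fun k => dtz p k = 0

def sPairs : Finset (Fin 21 × Fin 21) :=
  Finset.univ.filter fun p => p.1 < p.2 ∧ ∀ k, dtz p k = 0 → k = p.1 ∨ p.2 ≤ k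

lemma card2 : (sPairs.filter fun p => (zInt p).card = 2).card = 72 := by decide +kernel
lemma card3 : (sPairs.filter fun p => (zInt p).card = 3).card = 40 := by decide +kernel
lemma card4 : (sPairs.filter fun p => (zInt p).card = 4).card = 3 := by decide +kernel
lemma cardS : sPairs.card = 115 := by decide +kernel
lemma z_aux : (sPairs.filter fun p => ¬ (Nat.ble 2 (zInt p).card && Nat.ble (zInt p).card 4)).card
    = 0 := by decide +kernel
lemma z_le : ∀ p ∈ sPairs, (zInt p).card = 2 ∨ (zInt p).card = 3 ∨ (zInt p).card = 4 := by
  intro p hp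
  have h := Finset.filter_eq_empty_iff.1 (Finset.card_eq_zero.1 z_aux) hp
  simp only [not_not, Bool.and_eq_true, Nat.ble_eq] at h
  omega
lemma crz_ne : ∀ p : Fin 21 × Fin 21, p.1 < p.2 →
    (crz p).1 ≠ 0 ∨ (crz p).2.1 ≠ 0 ∨ (crz p).2.2 ≠ 0 := by
  decide +kernel
lemma dtz_self : ∀ p : Fin 21 × Fin 21, dtz p p.1 = 0 ∧ dtz p p.2 = 0 := by
  decide +kernel

lemma u_pos : 0 < u := by unfold u; positivity
lemma u_sq : u * u = 3 / 4 := by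
  unfold u
  have := Real.mul_self_sqrt (show (0:ℝ) ≤ 3 by norm_num)
  linear_combination this / 4

lemma rot_inv : rotA⁻¹ = !![1/2, u, 0; -u, 1/2, 0; 0, 0, 1] := by
  apply Matrix.inv_eq_left_inv
  have := u_sq
  ext i j
  fin_cases i <;> fin_cases j <;> simp [rotA, Matrix.mul_apply, Fin.sum_univ_three] <;>
    linarith

lemma rot2_inv : (rotA ^ 2)⁻¹ = !![-1/2, u, 0; -u, -1/2, 0; 0, 0, 1] := by
  rw [pow_two, Matrix.mul_inv_rev, rot_inv]
  have := u_sq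
  ext i j
  fin_cases i <;> fin_cases j <;> simp [Matrix.mul_apply, Fin.sum_univ_three] <;>
    linarith

/-- The form with integer coefficients. -/
noncomputable def fm (i : Fin 21) (w : ℝ × ℝ × ℝ) : ℝ :=
  ((cf i).1 : ℝ) * w.1 + ((cf i).2.1 : ℝ) * w.2.1 + ((cf i).2.2 : ℝ) * w.2.2

lemma eval_subst (M : Matrix (Fin 3) (Fin 3) ℝ) (v : Fin 3 → ℝ) (f : PolyR) :
    eval v (substMat M f) = eval (M.mulVec v) f := by
  unfold substMat
  induction f using MvPolynomial.induction_on with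
  | C a => simp
  | add p q hp hq => rw [map_add, map_add, map_add, hp, hq]
  | mul_X p n hp => rw [map_mul, map_mul, map_mul, hp]; simp [Matrix.mulVec, dotProduct]

noncomputable def sc : Fin 21 → ℝ :=
  ![u, u, u, u, 1, 1, 1, u/2, u/2, u/2, u/2, 1/4, 1/4, 1/4, u/2, u/2, u/2, u/2, 1/4, 1/4, 1/4]

lemma sc_ne (i : Fin 21) : sc i ≠ 0 := by
  have := u_pos.ne'
  fin_cases i <;> simp [sc, this]

lemma eval_line (i : Fin 21) (v : Fin 3 → ℝ) (x : ℝ) (hx : v 0 = u * x) :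
    eval v (linesB21 i) = sc i * fm i (x, v 1, v 2) := by
  have h := u_sq
  fin_cases i <;>
    simp [linesB21, eval_subst, rot_inv, rot2_inv, baseFormsB, Matrix.mulVec, dotProduct,
      Fin.sum_univ_three, hx, fm, cf, sc] <;> first | ring1 | linear_combination (-x) * h

open Classical in
noncomputable def zP (P : P2R) : Finset (Fin 21) :=
  Finset.univ.filter fun i => eval (Projectivization.rep P) (linesB21 i) = 0

lemma mult_eq (P : P2R) : multB21 P = (zP P).card := rfl

noncomputable def vec (p : Fin 21 × Fin 21) : Fin 3 → ℝ :=
  ![u * (crz p).1, ((crz p).2.1 : ℝ), ((crz p).2.2 : ℝ)]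

lemma vec_ne (p : Fin 21 × Fin 21) (h : p.1 < p.2) : vec p ≠ 0 := by
  intro h0
  have a0 := congrFun h0 0
  have a1 := congrFun h0 1
  have a2 := congrFun h0 2
  simp [vec, u_pos.ne'] at a0 a1 a2
  rcases crz_ne p h with h | h | h <;> exact h (by assumption)

lemma eval_vec (p : Fin 21 × Fin 21) (k : Fin 21) :
    eval (vec p) (linesB21 k) = 0 ↔ dtz p k = 0 := by
  rw [eval_line k (vec p) ((crz p).1 : ℝ) (by simp [vec])]
  simp only [mul_eq_zero, sc_ne, false_or]
  rw [← Int.cast_inj (α := ℝ)]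
  simp [fm, dtz, vec]

lemma eval_smul (c : ℝ) (v : Fin 3 → ℝ) (k : Fin 21) :
    eval (c • v) (linesB21 k) = c * eval v (linesB21 k) := by
  have hu := u_pos.ne'
  rw [eval_line k v (v 0 / u) (by field_simp),
    eval_line k (c • v) (c * (v 0 / u)) (by simp; field_simp)]
  simp [fm]; ring

open Classical in
noncomputable def pt (p : Fin 21 × Fin 21) : P2R :=
  if h : p.1 < p.2 then Projectivization.mk ℝ (vec p) (vec_ne p h)
  else Projectivization.mk ℝ (vec (0, 1)) (vec_ne _ (by decide))

lemma zP_pt (p : Fin 21 × Fin 21) (h : p.1 < p.2) : zP (pt p) = zInt p := by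
  obtain ⟨a, ha⟩ := Projectivization.exists_smul_eq_mk_rep ℝ (vec p) (vec_ne p h)
  ext k
  simp only [zP, zInt, Finset.mem_filter, Finset.mem_univ, true_and, pt, h, dif_pos]
  rw [← ha, Units.smul_def, eval_smul, ← eval_vec]
  simp

lemma pt_of_mem (P : P2R) (p : Fin 21 × Fin 21) (h : p.1 < p.2) (h1 : p.1 ∈ zP P)
    (h2 : p.2 ∈ zP P) : P = pt p := by
  have hu := u_pos.ne'
  simp only [zP, Finset.mem_filter, Finset.mem_univ, true_and] at h1 h2
  rw [eval_line _ _ (P.rep 0 / u) (by field_simp)] at h1 h2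
  simp only [mul_eq_zero, sc_ne, false_or, fm] at h1 h2
  conv_lhs => rw [← P.mk_rep]
  simp only [pt, h, dif_pos]
  rw [Projectivization.mk_eq_mk_iff']
  have hx : P.rep 0 = u * (P.rep 0 / u) := by field_simp
  generalize P.rep 0 / u = x at *
  generalize hv : P.rep = v at *
  have e1 : x * (crz p).2.1 = v 1 * (crz p).1 := by
    simp only [crz]; push_cast
    linear_combination ((cf p.2).2.2 : ℝ) * (-h1) + ((cf p.1).2.2 : ℝ) * h2
  have e2 : v 1 * (crz p).2.2 = v 2 * (crz p).2.1 := by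
    simp only [crz]; push_cast
    linear_combination ((cf p.2).1 : ℝ) * (-h1) + ((cf p.1).1 : ℝ) * h2
  have e3 : v 2 * (crz p).1 = x * (crz p).2.2 := by
    simp only [crz]; push_cast
    linear_combination ((cf p.2).2.1 : ℝ) * (-h1) + ((cf p.1).2.1 : ℝ) * h2
  rcases crz_ne p h with h | h | h
  · have h' : ((crz p).1 : ℝ) ≠ 0 := by exact_mod_cast h
    refine ⟨x / (crz p).1, ?_⟩
    ext k
    fin_cases k <;> simp [vec, hx] <;> field_simp <;> linarith
  · have h' : ((crz p).2.1 : ℝ) ≠ 0 := by exact_mod_cast h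
    refine ⟨v 1 / (crz p).2.1, ?_⟩
    ext k
    fin_cases k <;> simp [vec, hx] <;> field_simp <;> linarith
  · have h' : ((crz p).2.2 : ℝ) ≠ 0 := by exact_mod_cast h
    refine ⟨v 2 / (crz p).2.2, ?_⟩
    ext k
    fin_cases k <;> simp [vec, hx] <;> field_simp <;> linarith

lemma mem_sPairs (p : Fin 21 × Fin 21) :
    p ∈ sPairs ↔ p.1 < p.2 ∧ ∀ k ∈ zInt p, k = p.1 ∨ p.2 ≤ k := by
  simp [sPairs, zInt]

lemma exists_pair (P : P2R) (h : 2 ≤ multB21 P) : ∃ p ∈ sPairs, pt p = P := by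
  rw [mult_eq] at h
  have hne : (zP P).Nonempty := Finset.card_pos.1 (by omega)
  have hi := Finset.min'_mem _ hne
  set i := (zP P).min' hne with hidef
  have hne2 : ((zP P).erase i).Nonempty :=
    Finset.card_pos.1 (by rw [Finset.card_erase_of_mem hi]; omega)
  have hj := Finset.min'_mem _ hne2
  set j := ((zP P).erase i).min' hne2 with hjdef
  have hj' := Finset.mem_erase.1 hj
  have hij : i < j := lt_of_le_of_ne (Finset.min'_le _ _ hj'.2) (Ne.symm hj'.1)
  have hP := pt_of_mem P (i, j) hij hi hj'.2
  refine ⟨(i, j), ?_, hP.symm⟩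
  rw [mem_sPairs]
  refine ⟨hij, fun k hk => ?_⟩
  rw [← zP_pt _ hij, ← hP] at hk
  by_cases hki : k = i
  · exact Or.inl hki
  · exact Or.inr (Finset.min'_le _ _ (Finset.mem_erase.2 ⟨hki, hk⟩))

lemma pt_inj : Set.InjOn pt (sPairs : Set (Fin 21 × Fin 21)) := by
  intro p hp q hq hpq
  rw [Finset.mem_coe, mem_sPairs] at hp hq
  have hz : zInt p = zInt q := by rw [← zP_pt p hp.1, ← zP_pt q hq.1, hpq]
  have mp1 : p.1 ∈ zInt p := by simp [zInt, dtz_self p]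
  have mp2 : p.2 ∈ zInt p := by simp [zInt, dtz_self p]
  have mq1 : q.1 ∈ zInt q := by simp [zInt, dtz_self q]
  have mq2 : q.2 ∈ zInt q := by simp [zInt, dtz_self q]
  have a := hp.2 _ (hz ▸ mq1)
  have b := hp.2 _ (hz ▸ mq2)
  have c := hq.2 _ (hz ▸ mp1)
  have d := hq.2 _ (hz ▸ mp2)
  have e := hp.1
  have f := hq.1
  apply Prod.ext <;> omega

lemma ncard_gen (m : ℕ) (hm : 2 ≤ m) :
    {P : P2R | multB21 P = m}.ncard = (sPairs.filter fun p => (zInt p).card = m).card := by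
  have : {P : P2R | multB21 P = m} =
      pt '' ((sPairs.filter fun p => (zInt p).card = m : Finset _) : Set _) := by
    ext P
    simp only [Set.mem_ofPred_eq, Set.mem_image, Finset.mem_coe, Finset.mem_filter]
    constructor
    · intro h
      obtain ⟨p, hp, rfl⟩ := exists_pair P (by omega)
      refine ⟨p, ⟨hp, ?_⟩, rfl⟩
      rw [← zP_pt p ((mem_sPairs p).1 hp).1]; exact h
    · rintro ⟨p, ⟨hp, h⟩, rfl⟩
      rw [mult_eq, zP_pt p ((mem_sPairs p).1 hp).1, h]
  rw [this, Set.InjOn.ncard_image (pt_inj.mono (by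
    intro p hp; exact (Finset.mem_filter.1 (Finset.mem_coe.1 hp)).1)), Set.ncard_coe_finset]

lemma mult_mem (P : P2R) (h : 2 ≤ multB21 P) :
    multB21 P = 2 ∨ multB21 P = 3 ∨ multB21 P = 4 := by
  obtain ⟨p, hp, rfl⟩ := exists_pair P h
  rw [mult_eq, zP_pt p ((mem_sPairs p).1 hp).1]
  exact z_le p hp

lemma ncard_T : T21.ncard = 115 := by
  have : T21 = pt '' (sPairs : Set _) := by
    ext P
    simp only [T21, Set.mem_ofPred_eq, Set.mem_image, Finset.mem_coe]
    constructor
    · exact exists_pair P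
    · rintro ⟨p, hp, rfl⟩
      rw [mult_eq, zP_pt p ((mem_sPairs p).1 hp).1]
      have := z_le p hp
      omega
  rw [this, Set.InjOn.ncard_image pt_inj, Set.ncard_coe_finset, cardS]

/-- The arrangement `B₂₁` has exactly 115 intersection points, with multiplicity vector
`t₂ = 72`, `t₃ = 40`, `t₄ = 3`, and `tᵢ = 0` for all other `i ≥ 2`. -/
theorem stmt7 :
    T21.ncard = 115 ∧
    {P : P2R | multB21 P = 2}.ncard = 72 ∧
    {P : P2R | multB21 P = 3}.ncard = 40 ∧
    {P : P2R | multB21 P = 4}.ncard = 3 ∧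
    ∀ i : ℕ, 2 ≤ i → i ∉ ({2, 3, 4} : Set ℕ) →
      {P : P2R | multB21 P = i} = ∅ := by
  exact ⟨ncard_T, (ncard_gen 2 (by norm_num)).trans card2, (ncard_gen 3 (by norm_num)).trans card3,
    (ncard_gen 4 (by norm_num)).trans card4, by
      intro i hi hni
      ext P
      simp only [Set.mem_ofPred_eq, Set.mem_empty_iff_false, iff_false]
      intro h
      have := mult_mem P (by omega)
      rw [h] at this
      exact hni (by simpa using this)⟩
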